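/- Let q ∈ (2, 2*) (2* = 2N/(N−2) if N ≥ 3, 2* = ∞ if N = 1,2). There is a constant C > 0 depending only on N, q, and inf V > 0, such that for every L ∈ ℕ and every 2L-periodic u ∈ H¹_loc(ℝᴺ): ‖u‖_{L^q(D_L)}^q ≤ C·(sup_{n∈ℤᴺ} ‖u‖_{L^q(D_1(n))})^{q−2}·∫_{D_L}(|∇u|² + V(x)u²), where D_L = [−L,L]ᴺ and D_1(n) = n + [−1,1]ᴺ. -/

import Mathlib

open MeasureTheory

/-- The cube `[-L, L]^N`. -/
def DL (N : ℕ) (L : ℝ) : Set (EuclideanSpace ℝ (Fin N)) := {x | ∀ i, |x i| ≤ L}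

/-- The unit cube `n + [-1, 1]^N` around `n ∈ ℤ^N`. -/
def D1 (N : ℕ) (n : Fin N → ℤ) : Set (EuclideanSpace ℝ (Fin N)) :=
  {x | ∀ i, |x i - n i| ≤ 1}

open scoped NNReal ENNReal

theorem DL_closed (N : ℕ) (L : ℝ) : IsClosed (DL N L) := by
  have : DL N L = ⋂ i, {x | |x i| ≤ L} := by ext; simp [DL]
  rw [this]
  exact isClosed_iInter fun i => isClosed_le (by fun_prop) continuous_const

theorem DL_compact (N : ℕ) (L : ℝ) : IsCompact (DL N L) := by
  refine Metric.isCompact_of_isClosed_isBounded (DL_closed N L) ?_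
  refine (Metric.isBounded_closedBall (x := (0 : EuclideanSpace ℝ (Fin N)))
    (r := √(∑ _i : Fin N, L ^ 2))).subset ?_
  intro x hx
  rw [mem_closedBall_zero_iff, EuclideanSpace.norm_eq]
  gcongr with i
  exact hx i

theorem sob_one (q : ℝ≥0) (hq : 2 < q) :
    ∃ C : ℝ≥0, ∀ w : EuclideanSpace ℝ (Fin 1) → ℝ, ContDiff ℝ 1 w →
      w.support ⊆ DL 1 1 →
      eLpNorm w q volume ≤ C * eLpNorm (fderiv ℝ w) (1 : ℝ≥0) volume := by
  have hfin : volume (DL 1 1) ≠ ∞ := (DL_compact 1 1).measure_ne_top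
  refine ⟨((volume (DL 1 1)) ^ ((q : ℝ)⁻¹)).toNNReal, fun w hw hs => ?_⟩
  rw [ENNReal.coe_toNNReal (by finiteness)]
  have hcs : HasCompactSupport w :=
    HasCompactSupport.of_support_subset_isCompact (DL_compact 1 1) hs
  have hmp : MeasurePreserving (fun t : ℝ => (WithLp.toLp 2 (fun _ : Fin 1 => t))) volume volume :=
    (PiLp.volume_preserving_toLp (Fin 1)).comp (volume_preserving_funUnique (Fin 1) ℝ).symm
  let ι : ℝ →L[ℝ] EuclideanSpace ℝ (Fin 1) :=
    (PiLp.continuousLinearEquiv 2 ℝ (fun _ : Fin 1 => ℝ)).symm.toContinuousLinearMap ∘L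
      (ContinuousLinearMap.pi fun _ => ContinuousLinearMap.id ℝ ℝ)
  have hι : ∀ t, ι t = WithLp.toLp 2 (fun _ : Fin 1 => t) := fun t => rfl
  have hιn : ∀ t, ‖ι t‖ = ‖t‖ := by
    intro t; rw [hι, EuclideanSpace.norm_eq]; simp [Real.sqrt_sq_eq_abs]
  have hiso : Isometry ι := AddMonoidHomClass.isometry_of_norm ι hιn
  have hpt : ∀ x, ‖w x‖ₑ ≤ eLpNorm (fderiv ℝ w) (1 : ℝ≥0) volume := by
    intro x
    have hx : x = ι (x 0) := by ext i; fin_cases i; simp [hι]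
    rw [hx]
    calc ‖w (ι (x 0))‖ₑ ≤ ∫⁻ y in Set.Iic (x 0), ‖deriv (w ∘ ι) y‖ₑ :=
          HasCompactSupport.enorm_le_lintegral_Ici_deriv (f := w ∘ ι) (hw.comp ι.contDiff)
            (hcs.comp_isClosedEmbedding hiso.isClosedEmbedding) _
      _ ≤ ∫⁻ y, ‖deriv (w ∘ ι) y‖ₑ := setLIntegral_le_lintegral _ _
      _ ≤ ∫⁻ y, ‖fderiv ℝ w (ι y)‖ₑ := by
          refine lintegral_mono fun y => ?_
          have h1 : HasDerivAt (w ∘ ι) (fderiv ℝ w (ι y) (ι 1)) y :=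
            ((hw.differentiable (by norm_num) (ι y)).hasFDerivAt).comp_hasDerivAt y ι.hasDerivAt
          rw [h1.deriv, enorm_le_iff_norm_le]
          refine (ContinuousLinearMap.le_opNorm _ _).trans ?_
          rw [hιn]; simp
      _ = ∫⁻ y, ‖fderiv ℝ w y‖ₑ :=
          hmp.lintegral_comp (f := fun y => ‖fderiv ℝ w y‖ₑ)
            (hw.continuous_fderiv (by norm_num)).enorm.measurable
      _ = _ := by rw [ENNReal.coe_one, eLpNorm_one_eq_lintegral_enorm]
  rw [← eLpNorm_restrict_eq_of_support_subset hs]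
  have hq0 : q ≠ 0 := by rintro rfl; simp at hq
  rw [eLpNorm_nnreal_eq_lintegral hq0]
  calc (∫⁻ x in DL 1 1, ‖w x‖ₑ ^ (q : ℝ)) ^ (1 / (q : ℝ))
      ≤ (∫⁻ x in DL 1 1, (eLpNorm (fderiv ℝ w) (1 : ℝ≥0) volume) ^ (q : ℝ)) ^ (1 / (q : ℝ)) := by
        gcongr with x; exact hpt x
    _ = _ := by
      rw [setLIntegral_const, ENNReal.mul_rpow_of_nonneg _ _ (by positivity), ← ENNReal.rpow_mul,
        mul_one_div_cancel (by exact_mod_cast hq0), ENNReal.rpow_one, mul_comm, one_div]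

theorem sob_p (N : ℕ) (hN : 1 ≤ N) (q : ℝ≥0) (hq2 : 2 < q)
    (hqs : 3 ≤ N → (q : ℝ) < 2 * (N : ℝ) / ((N : ℝ) - 2)) :
    ∃ p : ℝ≥0, 1 ≤ p ∧ p ≤ 2 ∧ ∃ C : ℝ≥0, ∀ w : EuclideanSpace ℝ (Fin N) → ℝ, ContDiff ℝ 1 w →
      w.support ⊆ DL N 1 →
      eLpNorm w q volume ≤ C * eLpNorm (fderiv ℝ w) p volume := by
  have hq' : (2 : ℝ) < q := by exact_mod_cast hq2
  rcases (show N = 1 ∨ N = 2 ∨ 3 ≤ N by omega) with rfl | rfl | h3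
  · exact ⟨1, le_rfl, by norm_num, sob_one q hq2⟩
  · have hp1 : (1 : ℝ≥0) ≤ 2 * q / (q + 2) := by
      rw [← NNReal.coe_le_coe]; push_cast
      rw [le_div_iff₀ (by positivity)]; linarith
    have hp2 : 2 * q / (q + 2) < 2 := by
      rw [← NNReal.coe_lt_coe]; push_cast
      rw [div_lt_iff₀ (by positivity)]; linarith
    refine ⟨2 * q / (q + 2), hp1, hp2.le, _, fun w hw hs =>
      eLpNorm_le_eLpNorm_fderiv_of_le volume hw hs hp1 ?_ ?_ (DL_compact 2 1).isBounded⟩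
    · simpa using hp2
    · simp only [finrank_euclideanSpace, Fintype.card_fin]
      push_cast
      apply le_of_eq
      field_simp
      ring
  · have h3' : (3 : ℝ) ≤ N := by exact_mod_cast h3
    refine ⟨2, by norm_num, le_rfl, _, fun w hw hs =>
      eLpNorm_le_eLpNorm_fderiv_of_le volume hw hs (by norm_num) ?_ ?_ (DL_compact N 1).isBounded⟩
    · simp only [finrank_euclideanSpace, Fintype.card_fin]
      exact_mod_cast (by omega : 2 < N)
    · simp only [finrank_euclideanSpace, Fintype.card_fin]
      have h := hqs h3
      push_cast
      have h4 : (2 : ℝ)⁻¹ - (N : ℝ)⁻¹ = (2 * N / (N - 2) : ℝ)⁻¹ := by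
        have : (N : ℝ) - 2 ≠ 0 := by linarith
        field_simp
      rw [h4]
      gcongr

theorem holder_supp {E F : Type*} [MeasurableSpace E] (μ : Measure E) [NormedAddCommGroup F]
    (f : E → F) (s : Set E) (hf : AEStronglyMeasurable f (μ.restrict s)) (hs : f.support ⊆ s)
    (p : ℝ≥0) (hp : p ≤ 2) :
    eLpNorm f p μ ≤ (μ s) ^ (1 / (p : ℝ) - 1 / (2 : ℝ)) *
      eLpNorm f (2 : ℝ≥0) (μ.restrict s) := by
  rw [← eLpNorm_restrict_eq_of_support_subset hs]
  have := eLpNorm_le_eLpNorm_mul_rpow_measure_univ (f := f) (p := (p : ℝ≥0∞))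
    (q := ((2 : ℝ≥0) : ℝ≥0∞)) (μ := μ.restrict s) (by exact_mod_cast hp) hf
  rw [Measure.restrict_apply_univ, mul_comm] at this
  simpa using this

theorem sob_two (N : ℕ) (hN : 1 ≤ N) (q : ℝ≥0) (hq2 : 2 < q)
    (hqs : 3 ≤ N → (q : ℝ) < 2 * (N : ℝ) / ((N : ℝ) - 2)) :
    ∃ C : ℝ≥0, ∀ w : EuclideanSpace ℝ (Fin N) → ℝ, ContDiff ℝ 1 w →
      w.support ⊆ DL N 1 →
      eLpNorm w q volume ≤ C * eLpNorm (fderiv ℝ w) (2 : ℝ≥0) (volume.restrict (DL N 1)) := by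
  obtain ⟨p, hp1, hp2, C, hC⟩ := sob_p N hN q hq2 hqs
  have hfin : volume (DL N 1) ≠ ∞ := (DL_compact N 1).measure_ne_top
  have he : 0 ≤ 1 / (p : ℝ) - 1 / (2 : ℝ) := by
    have : (p : ℝ) ≤ 2 := by exact_mod_cast hp2
    have : (1 : ℝ) ≤ p := by exact_mod_cast hp1
    rw [sub_nonneg]; gcongr
  refine ⟨C * ((volume (DL N 1)) ^ (1 / (p : ℝ) - 1 / (2 : ℝ))).toNNReal, fun w hw hs => ?_⟩
  refine (hC w hw hs).trans ?_
  rw [ENNReal.coe_mul, ENNReal.coe_toNNReal (by finiteness), mul_assoc]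
  refine mul_le_mul' le_rfl ?_
  have hs' : (fderiv ℝ w).support ⊆ DL N 1 :=
    (support_fderiv_subset ℝ).trans (closure_minimal hs (DL_closed N 1))
  exact holder_supp volume (fderiv ℝ w) (DL N 1)
    (hw.continuous_fderiv (by norm_num)).aestronglyMeasurable hs' p hp2

theorem cutoff (N : ℕ) : ∃ (η : EuclideanSpace ℝ (Fin N) → ℝ) (K : ℝ≥0), ContDiff ℝ 1 η ∧
    η.support ⊆ DL N 1 ∧ (∀ x ∈ DL N (1/2), η x = 1) ∧ (∀ x, ‖η x‖ ≤ K) ∧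
    ∀ x, ‖fderiv ℝ η x‖ ≤ K := by
  let b : ContDiffBump (0 : Fin N → ℝ) := ⟨1/2, 1, by norm_num, by norm_num⟩
  let e := PiLp.continuousLinearEquiv 2 ℝ (fun _ : Fin N => ℝ)
  have hc : ContDiff ℝ 1 (fun x => b (e x)) := b.contDiff.comp e.contDiff
  have hs : (fun x => b (e x)).support ⊆ DL N 1 := by
    intro x hx
    have : e x ∈ Function.support b := hx
    rw [b.support_eq, mem_ball_zero_iff] at this
    intro i
    exact (norm_le_pi_norm (e x) i).trans this.le
  have hcs : HasCompactSupport (fun x => b (e x)) :=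
    HasCompactSupport.of_support_subset_isCompact (DL_compact N 1) hs
  obtain ⟨K1, h1⟩ := hc.continuous.bounded_above_of_compact_support hcs
  obtain ⟨K2, h2⟩ := (hc.continuous_fderiv (by norm_num)).bounded_above_of_compact_support
    (hcs.fderiv ℝ)
  refine ⟨fun x => b (e x), (max K1 K2).toNNReal, hc, hs, ?_, ?_, ?_⟩
  · intro x hx
    apply b.one_of_mem_closedBall
    rw [mem_closedBall_zero_iff]
    exact (pi_norm_le_iff_of_nonneg (by norm_num [b])).2 hx
  · intro x
    exact ((h1 x).trans (le_max_left _ _)).trans (Real.le_coe_toNNReal _)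
  · intro x
    exact ((h2 x).trans (le_max_right _ _)).trans (Real.le_coe_toNNReal _)

theorem local_est (N : ℕ) (hN : 1 ≤ N) (q : ℝ≥0) (hq2 : 2 < q)
    (hqs : 3 ≤ N → (q : ℝ) < 2 * (N : ℝ) / ((N : ℝ) - 2)) :
    ∃ C : ℝ≥0, ∀ v : EuclideanSpace ℝ (Fin N) → ℝ, ContDiff ℝ 1 v →
      ∫⁻ x in DL N (1/2), ‖v x‖ₑ ^ (q : ℝ) ≤
        (∫⁻ x in DL N 1, ‖v x‖ₑ ^ (q : ℝ)) ^ (((q : ℝ) - 2) / q) *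
        (C * ∫⁻ x in DL N 1, (‖fderiv ℝ v x‖ₑ ^ 2 + ‖v x‖ₑ ^ 2)) := by
  obtain ⟨C, hC⟩ := sob_two N hN q hq2 hqs
  obtain ⟨η, K, hη, hηs, hη1, hK0, hK1⟩ := cutoff N
  refine ⟨C ^ 2 * (2 * K ^ 2), fun v hv => ?_⟩
  have hq' : (2 : ℝ) < q := by exact_mod_cast hq2
  have hq0 : q ≠ 0 := by rintro rfl; simp at hq2
  set A := ∫⁻ x in DL N (1/2), ‖v x‖ₑ ^ (q : ℝ) with hA
  set w := fun x => η x * v x with hw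
  have hwc : ContDiff ℝ 1 w := hη.mul hv
  have hws : w.support ⊆ DL N 1 := (Function.support_mul_subset_left η v).trans hηs
  have h12 : DL N (1/2) ⊆ DL N 1 := fun x hx i => (hx i).trans (by norm_num)
  -- A^(1/q) ≤ C * ...
  have h1 : A ^ (1 / (q : ℝ)) ≤ eLpNorm w q volume := by
    rw [eLpNorm_nnreal_eq_lintegral hq0]
    gcongr
    calc A = ∫⁻ x in DL N (1/2), ‖w x‖ₑ ^ (q : ℝ) := by
          refine setLIntegral_congr_fun (DL_closed N _).measurableSet fun x hx => ?_
          simp [hw, hη1 x hx]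
      _ ≤ _ := setLIntegral_le_lintegral _ _
  have h2 : (eLpNorm (fderiv ℝ w) (2 : ℝ≥0) (volume.restrict (DL N 1))) ^ 2 ≤
      (2 * K ^ 2) * ∫⁻ x in DL N 1, (‖fderiv ℝ v x‖ₑ ^ 2 + ‖v x‖ₑ ^ 2) := by
    have := eLpNorm_nnreal_pow_eq_lintegral (f := fderiv ℝ w) (μ := volume.restrict (DL N 1))
      (p := 2) (by norm_num)
    norm_num at this
    norm_num
    rw [this, ← lintegral_const_mul' _ _ (by finiteness)]
    refine lintegral_mono fun x => ?_
    have hd : fderiv ℝ w x = η x • fderiv ℝ v x + v x • fderiv ℝ η x :=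
      fderiv_fun_mul (hη.differentiable (by norm_num) x) (hv.differentiable (by norm_num) x)
    have hn : ‖fderiv ℝ w x‖ ^ 2 ≤ (2 * K ^ 2) * (‖fderiv ℝ v x‖ ^ 2 + ‖v x‖ ^ 2) := by
      have : ‖fderiv ℝ w x‖ ≤ K * (‖fderiv ℝ v x‖ + ‖v x‖) := by
        rw [hd]
        refine (norm_add_le _ _).trans ?_
        rw [norm_smul, norm_smul, mul_add, mul_comm (‖v x‖)]
        gcongr
        · exact hK0 x
        · exact hK1 x
      calc _ ≤ (K * (‖fderiv ℝ v x‖ + ‖v x‖)) ^ 2 := by gcongr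
        _ ≤ _ := by
          have : 0 ≤ (K : ℝ) ^ 2 * (‖fderiv ℝ v x‖ - ‖v x‖) ^ 2 := by positivity
          nlinarith
    have hn' : ‖fderiv ℝ w x‖₊ ^ 2 ≤ (2 * K ^ 2) * (‖fderiv ℝ v x‖₊ ^ 2 + ‖v x‖₊ ^ 2) := by
      exact_mod_cast hn
    simp only [enorm_eq_nnnorm]
    exact_mod_cast hn'
  have h3 : A ^ (2 / (q : ℝ)) ≤ (C ^ 2 * (2 * K ^ 2) : ℝ≥0) *
      ∫⁻ x in DL N 1, (‖fderiv ℝ v x‖ₑ ^ 2 + ‖v x‖ₑ ^ 2) := by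
    calc A ^ (2 / (q : ℝ)) = (A ^ (1 / (q : ℝ))) ^ 2 := by
          rw [← ENNReal.rpow_natCast, ← ENNReal.rpow_mul]; congr 1; push_cast; ring
      _ ≤ (C * eLpNorm (fderiv ℝ w) (2 : ℝ≥0) (volume.restrict (DL N 1))) ^ 2 := by
          gcongr; exact h1.trans (hC w hwc hws)
      _ = C ^ 2 * (eLpNorm (fderiv ℝ w) (2 : ℝ≥0) (volume.restrict (DL N 1))) ^ 2 := mul_pow _ _ _
      _ ≤ C ^ 2 * ((2 * K ^ 2) * ∫⁻ x in DL N 1, (‖fderiv ℝ v x‖ₑ ^ 2 + ‖v x‖ₑ ^ 2)) := by gcongr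
      _ = _ := by push_cast; simp only [mul_assoc]
  calc A = A ^ (((q : ℝ) - 2) / q) * A ^ (2 / (q : ℝ)) := by
        rw [← ENNReal.rpow_add_of_nonneg _ _ (div_nonneg (by linarith) (by positivity))
          (by positivity)]
        rw [← add_div, sub_add_cancel, div_self (by positivity), ENNReal.rpow_one]
    _ ≤ _ := mul_le_mul' (ENNReal.rpow_le_rpow (lintegral_mono_set h12)
        (div_nonneg (by linarith) (by positivity))) h3

theorem cover_le {α ι : Type*} [MeasurableSpace α] (μ : Measure α) (D : Set α) (s : Finset ι)
    (t : ι → Set α) (h : ∀ x ∈ D, ∃ n ∈ s, x ∈ t n) (f : α → ℝ≥0∞) :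
    ∫⁻ x in D, f x ∂μ ≤ ∑ n ∈ s, ∫⁻ x in t n, f x ∂μ := by
  calc ∫⁻ x in D, f x ∂μ ≤ ∫⁻ x in ⋃ n : s, t n, f x ∂μ := by
        refine lintegral_mono_set fun x hx => ?_
        obtain ⟨n, hn, hx⟩ := h x hx
        exact Set.mem_iUnion.2 ⟨⟨n, hn⟩, hx⟩
    _ ≤ ∑' n : s, ∫⁻ x in t n, f x ∂μ := lintegral_iUnion_le _ _
    _ = _ := Finset.tsum_subtype s (fun n => ∫⁻ x in t n, f x ∂μ)

theorem trans_eq {N : ℕ} (a : EuclideanSpace ℝ (Fin N)) (D : Set (EuclideanSpace ℝ (Fin N)))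
    (f : EuclideanSpace ℝ (Fin N) → ℝ≥0∞) :
    ∫⁻ x in D, f (x + a) = ∫⁻ x in {x | x - a ∈ D}, f x := by
  have := (measurePreserving_add_right volume a).setLIntegral_comp_preimage_emb
    (measurableEmbedding_addRight a) f {x | x - a ∈ D}
  rw [← this]
  congr 2
  ext x; simp

theorem box3_card (N : ℕ) :
    (Fintype.piFinset (fun _ : Fin N => Finset.Icc (-1 : ℤ) 1)).card = 3 ^ N := by
  simp

theorem cover3 {N : ℕ} (L : ℕ) (hL : 0 < L) (f : EuclideanSpace ℝ (Fin N) → ℝ≥0∞)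
    (hf : ∀ (x : EuclideanSpace ℝ (Fin N)) (n : Fin N → ℤ),
      f (x + WithLp.toLp 2 (fun i => 2 * (L : ℝ) * (n i))) = f x) :
    ∫⁻ x in DL N (3 * L), f x ≤ 3 ^ N * ∫⁻ x in DL N L, f x := by
  have hL' : (0 : ℝ) < L := by exact_mod_cast hL
  refine (cover_le volume (DL N (3 * L)) (Fintype.piFinset (fun _ : Fin N => Finset.Icc (-1 : ℤ) 1))
    (fun n => {x | x - WithLp.toLp 2 (fun i => 2 * (L : ℝ) * (n i)) ∈ DL N L}) ?_ f).trans ?_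
  · intro x hx
    have : ∀ i, ∃ k : ℤ, k ∈ Finset.Icc (-1 : ℤ) 1 ∧ |x i - 2 * (L : ℝ) * k| ≤ L := by
      intro i
      have h := abs_le.1 (hx i)
      by_cases h1 : x i < -L
      · refine ⟨-1, by simp, abs_le.2 ⟨?_, ?_⟩⟩ <;> push_cast <;> linarith
      by_cases h2 : (L : ℝ) < x i
      · refine ⟨1, by simp, abs_le.2 ⟨?_, ?_⟩⟩ <;> push_cast <;> linarith
      · refine ⟨0, by simp, abs_le.2 ⟨?_, ?_⟩⟩ <;> push_cast <;> linarith
    choose k hk hk' using this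
    exact ⟨k, by simpa [Fintype.mem_piFinset] using hk, fun i => by simpa using hk' i⟩
  · apply le_of_eq
    rw [Finset.sum_congr rfl (g := fun _ => ∫⁻ x in DL N L, f x)]
    · rw [Finset.sum_const, box3_card, nsmul_eq_mul]; push_cast; rfl
    · intro n _
      rw [← trans_eq]
      simp only [hf]

theorem D1_compact {N : ℕ} (n : Fin N → ℤ) : IsCompact (D1 N n) := by
  have : D1 N n = (fun x => x + WithLp.toLp 2 (fun i => (n i : ℝ))) '' DL N 1 := by
    ext x
    constructor
    · intro hx
      exact ⟨x - WithLp.toLp 2 (fun i => (n i : ℝ)), hx, by simp⟩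
    · rintro ⟨y, hy, rfl⟩ i
      simpa using hy i
  rw [this]
  exact (DL_compact N 1).image (by fun_prop)

theorem overlap {N : ℕ} (L : ℕ) (hL : 0 < L) (f : EuclideanSpace ℝ (Fin N) → ℝ≥0∞)
    (hfm : Measurable f) :
    ∑ n ∈ Fintype.piFinset (fun _ : Fin N => Finset.Icc (-(L : ℤ)) L), ∫⁻ x in D1 N n, f x ≤
      3 ^ N * ∫⁻ x in DL N (3 * L), f x := by
  classical
  have hL' : (1 : ℝ) ≤ L := by exact_mod_cast hL
  have hm : ∀ n, MeasurableSet (D1 N n) := fun n => (D1_compact n).isClosed.measurableSet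
  calc _ = ∑ n ∈ Fintype.piFinset (fun _ : Fin N => Finset.Icc (-(L : ℤ)) L),
            ∫⁻ x, (D1 N n).indicator f x :=
        Finset.sum_congr rfl fun n _ => (lintegral_indicator (hm n) f).symm
    _ = ∫⁻ x, ∑ n ∈ Fintype.piFinset (fun _ : Fin N => Finset.Icc (-(L : ℤ)) L),
          (D1 N n).indicator f x :=
        (lintegral_finsetSum _ fun n _ => hfm.indicator (hm n)).symm
    _ ≤ ∫⁻ x, 3 ^ N * (DL N (3 * L)).indicator f x := by
        refine lintegral_mono fun x => ?_
        simp only [Set.indicator_apply]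
        rw [← Finset.sum_filter, Finset.sum_const, nsmul_eq_mul]
        by_cases hx : x ∈ DL N (3 * L)
        · rw [if_pos hx]
          gcongr
          have : (Finset.filter (fun n => x ∈ D1 N n)
              (Fintype.piFinset (fun _ : Fin N => Finset.Icc (-(L : ℤ)) L))).card ≤
              (Fintype.piFinset (fun _ : Fin N => Finset.Icc (-1 : ℤ) 1)).card := by
            refine Finset.card_le_card_of_injOn (fun n i => n i - round (x i)) ?_ ?_
            · intro n hn
              have hn' : x ∈ D1 N n := (Finset.mem_filter.1 hn).2
              rw [Finset.mem_coe, Fintype.mem_piFinset]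
              intro i
              have h1 := abs_le.1 (hn' i)
              have h2 := abs_le.1 (abs_sub_round (x i))
              have h3 : ((n i - round (x i) : ℤ) : ℝ) < ((2 : ℤ) : ℝ) := by push_cast; linarith
              have h4 : ((-2 : ℤ) : ℝ) < ((n i - round (x i) : ℤ) : ℝ) := by push_cast; linarith
              rw [Int.cast_lt] at h3 h4
              rw [Finset.mem_Icc]; dsimp only; omega
            · intro n _ m _ h
              funext i
              have := congrFun h i
              simp only at this
              omega
          rw [box3_card] at this
          exact_mod_cast this
        · rw [Finset.filter_false_of_mem]
          · simp
          · intro n hn hxn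
            refine hx fun i => ?_
            have h1 := abs_le.1 (hxn i)
            have h2 := Finset.mem_Icc.1 (Fintype.mem_piFinset.1 hn i)
            have h3 : (n i : ℝ) ≤ L := by exact_mod_cast h2.2
            have h4 : -(L : ℝ) ≤ n i := by exact_mod_cast h2.1
            exact abs_le.2 ⟨by linarith, by linarith⟩
    _ = _ := by
        rw [lintegral_const_mul' _ _ (by finiteness), lintegral_indicator (DL_closed _ _).measurableSet]

theorem cover_half {N : ℕ} (L : ℕ) (f : EuclideanSpace ℝ (Fin N) → ℝ≥0∞) :
    ∫⁻ x in DL N L, f x ≤ ∑ n ∈ Fintype.piFinset (fun _ : Fin N => Finset.Icc (-(L : ℤ)) L),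
      ∫⁻ x in DL N (1/2), f (x + WithLp.toLp 2 (fun i => (n i : ℝ))) := by
  simp only [trans_eq]
  refine cover_le volume _ _ _ ?_ f
  intro x hx
  refine ⟨fun i => round (x i), ?_, fun i => by simpa using abs_sub_round (x i)⟩
  rw [Fintype.mem_piFinset]
  intro i
  have h1 := abs_le.1 (hx i)
  have h2 := abs_le.1 (abs_sub_round (x i))
  have h3 : (round (x i) : ℝ) < ((L + 1 : ℤ) : ℝ) := by push_cast; linarith
  have h4 : ((-L - 1 : ℤ) : ℝ) < (round (x i) : ℝ) := by push_cast; linarith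
  rw [Int.cast_lt] at h3 h4
  rw [Finset.mem_Icc]; omega

theorem D1_eq {N : ℕ} (n : Fin N → ℤ) (f : EuclideanSpace ℝ (Fin N) → ℝ≥0∞) :
    ∫⁻ x in DL N 1, f (x + WithLp.toLp 2 (fun i => (n i : ℝ))) = ∫⁻ x in D1 N n, f x := by
  rw [trans_eq]; rfl

theorem bdd_periodic {N : ℕ} (L : ℕ) (hL : 0 < L) (u : EuclideanSpace ℝ (Fin N) → ℝ)
    (hu : Continuous u)
    (hper : ∀ (x : EuclideanSpace ℝ (Fin N)) (n : Fin N → ℤ),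
      u (x + WithLp.toLp 2 (fun i => 2 * (L : ℝ) * (n i))) = u x) :
    ∃ M : ℝ≥0, ∀ x, ‖u x‖ₑ ≤ M := by
  have hL' : (0 : ℝ) < L := by exact_mod_cast hL
  obtain ⟨M, hM⟩ := (DL_compact N L).exists_bound_of_continuousOn hu.continuousOn
  refine ⟨M.toNNReal, fun x => ?_⟩
  have : ‖u x‖ ≤ M := by
    rw [← hper x (fun i => - round (x i / (2 * L)))]
    apply hM
    intro i
    have h := abs_sub_round (x i / (2 * L))
    have : x i + 2 * L * (-(round (x i / (2 * L)) : ℝ)) =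
        (2 * L) * (x i / (2 * L) - round (x i / (2 * L))) := by field_simp; ring
    simp only [PiLp.add_apply, Int.cast_neg, this]
    rw [abs_mul, abs_of_pos (by positivity)]
    nlinarith
  rw [← ofReal_norm]
  exact ENNReal.ofReal_le_ofReal this

theorem torus_vanishing_lemma (N : ℕ) (hN : 1 ≤ N) (q V₀ : ℝ) (hq2 : 2 < q)
    (hqs : 3 ≤ N → q < 2 * (N : ℝ) / ((N : ℝ) - 2)) (hV₀ : 0 < V₀) :
    ∃ C > (0 : ℝ), ∀ V : EuclideanSpace ℝ (Fin N) → ℝ, Continuous V →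
      (∀ x, V₀ ≤ V x) → ∀ L : ℕ, 0 < L →
      ∀ u : EuclideanSpace ℝ (Fin N) → ℝ, ContDiff ℝ 1 u →
      (∀ (x : EuclideanSpace ℝ (Fin N)) (n : Fin N → ℤ),
        u (x + (WithLp.equiv 2 (Fin N → ℝ)).symm (fun i => 2 * (L : ℝ) * (n i))) = u x) →
      IntegrableOn (fun x => |u x| ^ q) (DL N L) volume →
      IntegrableOn (fun x => ‖fderiv ℝ u x‖ ^ 2 + V x * u x ^ 2) (DL N L) volume →
      (∫ x in DL N L, |u x| ^ q) ≤
        C * (⨆ n : Fin N → ℤ, (∫ x in D1 N n, |u x| ^ q) ^ (1 / q)) ^ (q - 2) *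
          ∫ x in DL N L, (‖fderiv ℝ u x‖ ^ 2 + V x * u x ^ 2) := by
  lift q to ℝ≥0 using by linarith
  have hq2' : 2 < q := by exact_mod_cast hq2
  obtain ⟨C, hC⟩ := local_est N hN q hq2' hqs
  have hm : 0 < min 1 V₀ := lt_min one_pos hV₀
  refine ⟨(C + 1) * 9 ^ N * (min 1 V₀)⁻¹, by positivity, ?_⟩
  intro V hV hVV L hL u hu hper hi1 hi2
  change ∀ (x : EuclideanSpace ℝ (Fin N)) (n : Fin N → ℤ),
        u (x + WithLp.toLp 2 (fun i => 2 * (L : ℝ) * (n i))) = u x at hper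
  have hq0 : (0 : ℝ) < q := by linarith
  have hg : ∀ x, ENNReal.ofReal (|u x| ^ (q : ℝ)) = ‖u x‖ₑ ^ (q : ℝ) := by
    intro x
    rw [← ENNReal.ofReal_rpow_of_nonneg (abs_nonneg _) hq0.le, ← Real.norm_eq_abs,
      ofReal_norm]
  have hgc : Continuous fun x => |u x| ^ (q : ℝ) :=
    hu.continuous.abs.rpow_const (fun _ => Or.inr hq0.le)
  have hI : ∀ D : Set (EuclideanSpace ℝ (Fin N)), IsCompact D →
      ENNReal.ofReal (∫ x in D, |u x| ^ (q : ℝ)) = ∫⁻ x in D, ‖u x‖ₑ ^ (q : ℝ) := by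
    intro D hD
    rw [ofReal_integral_eq_lintegral_ofReal]
    · simp only [hg]
    · exact hgc.continuousOn.integrableOn_compact hD
    · exact Filter.Eventually.of_forall fun x => by positivity
  obtain ⟨M, hM⟩ := bdd_periodic L hL u hu.continuous hper
  have hnn : ∀ n : Fin N → ℤ, 0 ≤ ∫ x in D1 N n, |u x| ^ (q : ℝ) :=
    fun n => integral_nonneg fun x => by positivity
  have hbdd : BddAbove (Set.range fun n : Fin N → ℤ =>
      (∫ x in D1 N n, |u x| ^ (q : ℝ)) ^ (1 / (q : ℝ))) := by
    have hfin : (M : ℝ≥0∞) ^ (q : ℝ) * volume (DL N 1) ≠ ∞ :=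
      ENNReal.mul_ne_top (by finiteness) (DL_compact N 1).measure_ne_top
    refine ⟨((M : ℝ≥0∞) ^ (q : ℝ) * volume (DL N 1)).toReal ^ (1 / (q : ℝ)), ?_⟩
    rintro _ ⟨n, rfl⟩
    refine Real.rpow_le_rpow (hnn n) ?_ (by positivity)
    rw [← ENNReal.ofReal_le_iff_le_toReal hfin, hI _ (D1_compact n),
      ← D1_eq n (fun x => ‖u x‖ₑ ^ (q : ℝ)), ← setLIntegral_const]
    exact lintegral_mono fun x => ENNReal.rpow_le_rpow (hM _) hq0.le
  set S := ⨆ n : Fin N → ℤ, (∫ x in D1 N n, |u x| ^ (q : ℝ)) ^ (1 / (q : ℝ)) with hS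
  have hS0 : 0 ≤ S := Real.iSup_nonneg fun n => Real.rpow_nonneg (hnn n) _
  have hSn : ∀ n, (∫⁻ x in D1 N n, ‖u x‖ₑ ^ (q : ℝ)) ^ (((q : ℝ) - 2) / q) ≤
      ENNReal.ofReal (S ^ ((q : ℝ) - 2)) := by
    intro n
    rw [← hI _ (D1_compact n), ENNReal.ofReal_rpow_of_nonneg (hnn n)
      (div_nonneg (by linarith) hq0.le)]
    apply ENNReal.ofReal_le_ofReal
    rw [show ((q : ℝ) - 2) / q = 1 / q * (q - 2) by ring, Real.rpow_mul (hnn n)]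
    exact Real.rpow_le_rpow (Real.rpow_nonneg (hnn n) _) (le_ciSup hbdd n) (by linarith)
  set f : EuclideanSpace ℝ (Fin N) → ℝ≥0∞ := fun x => ‖fderiv ℝ u x‖ₑ ^ 2 + ‖u x‖ₑ ^ 2 with hf
  have hfm : Measurable f :=
    (((hu.continuous_fderiv (by norm_num)).enorm.measurable.pow_const 2).add
      (hu.continuous.enorm.measurable.pow_const 2))
  have hfper : ∀ (x : EuclideanSpace ℝ (Fin N)) (n : Fin N → ℤ),
      f (x + WithLp.toLp 2 (fun i => 2 * (L : ℝ) * (n i))) = f x := by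
    intro x n
    simp only [hf, hper]
    rw [← fderiv_comp_add_right]
    simp only [hper]
  have hnnV : ∀ x, 0 ≤ ‖fderiv ℝ u x‖ ^ 2 + V x * u x ^ 2 := fun x => by
    have := hV₀.le.trans (hVV x); positivity
  set J := ∫ x in DL N L, (‖fderiv ℝ u x‖ ^ 2 + V x * u x ^ 2) with hJ
  have hJ0 : 0 ≤ J := integral_nonneg hnnV
  have hfJ : ∫⁻ x in DL N L, f x ≤ ENNReal.ofReal ((min 1 V₀)⁻¹ * J) := by
    rw [ENNReal.ofReal_mul (by positivity), hJ, ofReal_integral_eq_lintegral_ofReal hi2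
      (Filter.Eventually.of_forall hnnV), ← lintegral_const_mul' _ _ ENNReal.ofReal_ne_top]
    refine lintegral_mono fun x => ?_
    rw [← ENNReal.ofReal_mul (by positivity)]
    simp only [hf]
    rw [← ofReal_norm, ← ofReal_norm, ← ENNReal.ofReal_pow (norm_nonneg _),
      ← ENNReal.ofReal_pow (norm_nonneg _), ← ENNReal.ofReal_add (by positivity) (by positivity)]
    apply ENNReal.ofReal_le_ofReal
    rw [le_inv_mul_iff₀ hm, Real.norm_eq_abs (u x), sq_abs, mul_add]
    gcongr
    · exact mul_le_of_le_one_left (by positivity) (min_le_left _ _)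
    · exact (min_le_right _ _).trans (hVV x)
  have key : ENNReal.ofReal (∫ x in DL N L, |u x| ^ (q : ℝ)) ≤
      ENNReal.ofReal (S ^ ((q : ℝ) - 2)) * (C * (9 ^ N * ENNReal.ofReal ((min 1 V₀)⁻¹ * J))) := by
    rw [hI _ (DL_compact N L)]
    calc _ ≤ _ := cover_half L _
      _ ≤ ∑ n ∈ Fintype.piFinset (fun _ : Fin N => Finset.Icc (-(L : ℤ)) L),
            ENNReal.ofReal (S ^ ((q : ℝ) - 2)) * (C * ∫⁻ x in D1 N n, f x) := by
          refine Finset.sum_le_sum fun n _ => ?_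
          refine (hC (fun x => u (x + WithLp.toLp 2 (fun i => (n i : ℝ))))
            (hu.comp (contDiff_id.add contDiff_const))).trans ?_
          simp only [fderiv_comp_add_right]
          rw [D1_eq n (fun x => ‖u x‖ₑ ^ (q : ℝ)), D1_eq n f]
          exact mul_le_mul' (hSn n) le_rfl
      _ = ENNReal.ofReal (S ^ ((q : ℝ) - 2)) *
            (C * ∑ n ∈ Fintype.piFinset (fun _ : Fin N => Finset.Icc (-(L : ℤ)) L),
              ∫⁻ x in D1 N n, f x) := by rw [Finset.mul_sum, Finset.mul_sum]
      _ ≤ ENNReal.ofReal (S ^ ((q : ℝ) - 2)) *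
            (C * (3 ^ N * (3 ^ N * ENNReal.ofReal ((min 1 V₀)⁻¹ * J)))) := by
          gcongr
          refine (overlap L hL f hfm).trans ?_
          gcongr
          refine (cover3 L hL f hfper).trans ?_
          gcongr
      _ = _ := by
          rw [← mul_assoc (3 ^ N : ℝ≥0∞) (3 ^ N), ← mul_pow]; norm_num
  have hSr : 0 ≤ S ^ ((q : ℝ) - 2) := Real.rpow_nonneg hS0 _
  have key2 : ENNReal.ofReal (∫ x in DL N L, |u x| ^ (q : ℝ)) ≤
      ENNReal.ofReal (S ^ ((q : ℝ) - 2) * (C * (9 ^ N * ((min 1 V₀)⁻¹ * J)))) := by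
    refine key.trans (le_of_eq ?_)
    rw [ENNReal.ofReal_mul hSr, ENNReal.ofReal_mul (NNReal.coe_nonneg C), ENNReal.ofReal_mul (p := 9 ^ N) (by positivity),
      ENNReal.ofReal_coe_nnreal, ENNReal.ofReal_pow (by norm_num)]
    norm_num
  rw [ENNReal.ofReal_le_ofReal_iff (by positivity)] at key2
  refine key2.trans ?_
  have : 0 ≤ S ^ ((q : ℝ) - 2) * (9 ^ N * ((min 1 V₀)⁻¹ * J)) := by positivity
  nlinarith
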